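/- arXiv:0910.4035 — 2 statements merged into one kernel-verified Lean document; each statement's English description precedes it below -/
import Mathlib

section
/- Let M be a matrix of full rank type. Let G be a nonempty finite set of squarefree nonconstant monomials of A and let J be the ideal of A generated by G. Set n := #{i ∈ {1,…,ν} : a_i divides every element of G} and m := #{i ∈ {1,…,ν} : a_i divides no element of G}. Then for every integer k with k ≥ ν − m − 1: dim_ℂ (A/(J + I_M))_k = n. -/
open scoped BigOperators

/-- The dimension of the degree-`k` homogeneous component of `A/K`:
`dim_ℂ A_k − dim_ℂ (K ∩ A_k)`. -/
noncomputable def hdim {ν : ℕ} (K : Ideal (MvPolynomial (Fin ν) ℂ)) (k : ℕ) : ℕ :=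
  Module.finrank ℂ (MvPolynomial.homogeneousSubmodule (Fin ν) ℂ k) -
    Module.finrank ℂ
      (Submodule.restrictScalars ℂ K ⊓ MvPolynomial.homogeneousSubmodule (Fin ν) ℂ k :
        Submodule ℂ (MvPolynomial (Fin ν) ℂ))

/-- A `(ν−2)×ν` complex matrix is of full rank type if every `(ν−2)×(ν−2)` minor is nonzero. -/
def FullRankType (ν : ℕ) (M : Matrix (Fin (ν - 2)) (Fin ν) ℂ) : Prop :=
  ∀ g : Fin (ν - 2) ↪ Fin ν, (M.submatrix id g).det ≠ 0

/-- The ideal `I_M` generated by the `ν−2` linear forms `ℓ_j = Σ_i M_{j,i}·a_i`. -/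
noncomputable def IM {ν : ℕ} (M : Matrix (Fin (ν - 2)) (Fin ν) ℂ) :
    Ideal (MvPolynomial (Fin ν) ℂ) :=
  Ideal.span (Set.range fun j : Fin (ν - 2) =>
    ∑ i, MvPolynomial.C (M j i) * MvPolynomial.X i)

open MvPolynomial

namespace FullRankType

variable {ν : ℕ} {M : Matrix (Fin (ν - 2)) (Fin ν) ℂ}

lemma eq_zero_of_mulVec_eq_zero (hM : FullRankType ν M) {i j : Fin ν} (hij : i ≠ j)
    {u : Fin ν → ℂ} (hu : M.mulVec u = 0) (hi : u i = 0) (hj : u j = 0) : u = 0 := by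
  classical
  have hcard : (({i, j} : Finset (Fin ν))ᶜ).card = ν - 2 := by
    rw [Finset.card_compl, Finset.card_pair hij, Fintype.card_fin]
  let g := (({i, j} : Finset (Fin ν))ᶜ).orderEmbOfFin hcard
  have hg : ∀ l, l ≠ i → l ≠ j → ∃ a, g a = l := fun l h1 h2 => by
    have : l ∈ Set.range g := by simp [g, h1, h2]
    exact this
  have hz : u ∘ g = 0 := by
    refine Matrix.eq_zero_of_mulVec_eq_zero (hM g.toEmbedding) ?_
    ext r
    rw [← hu]
    simp only [Matrix.mulVec, dotProduct, Matrix.submatrix_apply, id, Function.comp]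
    refine Finset.sum_of_injOn g g.injective.injOn (by simp) (fun l _ hl => ?_) (fun _ _ => rfl)
    by_cases h1 : l = i
    · simp [h1, hi]
    by_cases h2 : l = j
    · simp [h2, hj]
    obtain ⟨a, rfl⟩ := hg l h1 h2
    simp at hl
  ext l
  by_cases h1 : l = i
  · simp [h1, hi]
  by_cases h2 : l = j
  · simp [h2, hj]
  obtain ⟨a, rfl⟩ := hg l h1 h2
  exact congrFun hz a

lemma exists_mulVec_eq_zero (hν : 3 ≤ ν) (hM : FullRankType ν M) (i : Fin ν) :
    ∃ u : Fin ν → ℂ, M.mulVec u = 0 ∧ u i = 0 ∧ ∀ l, l ≠ i → u l ≠ 0 := by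
  let F : (Fin ν → ℂ) →ₗ[ℂ] (Fin (ν - 2) → ℂ) × ℂ := M.mulVecLin.prod (LinearMap.proj i)
  have hF : LinearMap.ker F ≠ ⊥ := F.ker_ne_bot_of_finrank_lt (by simp; omega)
  obtain ⟨u, hu, hu0⟩ := Submodule.exists_mem_ne_zero_of_ne_bot hF
  have hu' : M.mulVec u = 0 ∧ u i = 0 := by simpa [F] using hu
  exact ⟨u, hu'.1, hu'.2, fun l hl h =>
    hu0 (hM.eq_zero_of_mulVec_eq_zero hl hu'.1 h hu'.2)⟩

lemma exists_X_sub_mem_IM (hM : FullRankType ν M) {i j : Fin ν} (hij : i ≠ j) (l : Fin ν) :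
    ∃ α β : ℂ, (X l - C α * X i - C β * X j : MvPolynomial (Fin ν) ℂ) ∈ IM M := by
  classical
  let F : (Fin ν → ℂ) →ₗ[ℂ] (Fin (ν - 2) → ℂ) × ℂ × ℂ :=
    M.mulVecLin.prod ((LinearMap.proj i).prod (LinearMap.proj j))
  have hF : LinearMap.ker F = ⊥ := by
    refine (Submodule.eq_bot_iff _).2 fun u hu => ?_
    have hu' : M.mulVec u = 0 ∧ u i = 0 ∧ u j = 0 := by simpa [F] using hu
    exact hM.eq_zero_of_mulVec_eq_zero hij hu'.1 hu'.2.1 hu'.2.2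
  obtain ⟨H, hH⟩ := F.exists_leftInverse_of_injective hF
  let φ : (Fin (ν - 2) → ℂ) × ℂ × ℂ →ₗ[ℂ] ℂ := LinearMap.proj l ∘ₗ H
  have hφ : ∀ u : Fin ν → ℂ, φ (F u) = u l := fun u => by
    exact congrFun (LinearMap.congr_fun hH u) l
  let y : Fin (ν - 2) → ℂ := fun r => φ (Pi.single r 1, 0, 0)
  have hdec : ∀ a b c, φ (a, b, c) = (∑ r, y r * a r) + φ (0, 1, 0) * b + φ (0, 0, 1) * c := by
    intro a b c
    have : (a, b, c) = (∑ r, a r • ((Pi.single r 1, 0, 0) : (Fin (ν - 2) → ℂ) × ℂ × ℂ))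
        + b • (0, 1, 0) + c • (0, 0, 1) := by
      refine Prod.ext ?_ (Prod.ext ?_ ?_)
      · ext s
        simp [Prod.fst_sum, Finset.sum_apply, Pi.single_apply]
      · simp [Prod.snd_sum]
      · simp [Prod.snd_sum]
    rw [this]
    simp only [map_add, map_sum, map_smul, smul_eq_mul, y]
    congr 1
    · congr 1
      · exact Finset.sum_congr rfl fun r _ => mul_comm _ _
      · ring
    · ring
  refine ⟨φ (0, 1, 0), φ (0, 0, 1), ?_⟩
  have hsum : (X l - C (φ (0, 1, 0)) * X i - C (φ (0, 0, 1)) * X j : MvPolynomial (Fin ν) ℂ)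
      = ∑ r, C (y r) * ∑ t, C (M r t) * X t := by
    have hX : ∀ t : Fin ν, (Pi.single l 1 : Fin ν → ℂ) t
        = (∑ r, y r * M r t) + φ (0, 1, 0) * (Pi.single i 1 : Fin ν → ℂ) t
          + φ (0, 0, 1) * (Pi.single j 1 : Fin ν → ℂ) t := by
      intro t
      have h := hφ (Pi.single t 1)
      have hFt : F (Pi.single t 1) = (fun r => M r t, (Pi.single t 1 : Fin ν → ℂ) i,
          (Pi.single t 1 : Fin ν → ℂ) j) := by
        refine Prod.ext ?_ rfl
        ext r
        simp [F]
      rw [hFt, hdec] at h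
      rw [Pi.single_comm l, Pi.single_comm i, Pi.single_comm j, h]
    have hsingle : ∀ s : Fin ν, (X s : MvPolynomial (Fin ν) ℂ)
        = ∑ t, C ((Pi.single s 1 : Fin ν → ℂ) t) * X t := fun s => by
      simp [Pi.single_apply, ite_mul, apply_ite C]
    rw [hsingle l, hsingle i, hsingle j]
    simp only [hX, Finset.mul_sum, map_add, map_mul, map_sum, add_mul, Finset.sum_add_distrib,
      Finset.sum_mul]
    rw [Finset.sum_comm]
    simp only [mul_assoc]
    ring
  rw [hsum]
  exact Ideal.sum_mem _ fun r _ => Ideal.mul_mem_left _ _ (Ideal.subset_span ⟨r, rfl⟩)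

end FullRankType

section Homogeneous

variable {σ : Type*}

lemma homogeneousSubmodule_succ_le {d : ℕ} {W : Submodule ℂ (MvPolynomial σ ℂ)}
    (h : ∀ s, ∀ r : MvPolynomial σ ℂ, r.IsHomogeneous d → X s * r ∈ W) :
    homogeneousSubmodule σ ℂ (d + 1) ≤ W := by
  rw [← homogeneousSubmodule_one_pow, pow_succ', homogeneousSubmodule_one_pow,
    homogeneousSubmodule_one_eq_span_X, Submodule.mul_le]
  intro x hx r hr
  induction hx using Submodule.span_induction with
  | mem x hx => obtain ⟨s, rfl⟩ := hx; exact h s r hr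
  | zero => simp
  | add x y _ _ hx hy => rw [add_mul]; exact W.add_mem hx hy
  | smul a x _ hx => rw [smul_mul_assoc]; exact W.smul_mem a hx

variable {I : Ideal (MvPolynomial σ ℂ)}

/-- Lagrange interpolation: modulo `I`, a form of degree at least `#Q - 1` is a combination of the
products of all but one of the variables in `Q`. -/
lemma homogeneousSubmodule_le_of_prod_erase_mem [DecidableEq σ]
    (hI : ∀ i j : σ, i ≠ j → ∀ l, ∃ α β : ℂ, X l - C α * X i - C β * X j ∈ I)
    {d : ℕ} {Q : Finset σ}
    (hQ : Q.Nonempty) {W : Submodule ℂ (MvPolynomial σ ℂ)} (hIW : I.restrictScalars ℂ ≤ W)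
    (hW : ∀ i ∈ Q, ∀ r : MvPolynomial σ ℂ, r.IsHomogeneous d → (∏ j ∈ Q.erase i, X j) * r ∈ W) :
    homogeneousSubmodule σ ℂ (Q.card - 1 + d) ≤ W := by
  induction hQ using Finset.Nonempty.cons_induction generalizing W with
  | singleton a =>
    intro r hr
    simpa using hW a (by simp) r (by simpa using hr)
  | cons s Q hs hQ ih =>
    have hcard : (Finset.cons s Q hs).card - 1 + d = Q.card - 1 + d + 1 := by
      have := hQ.card_pos
      rw [Finset.card_cons]; omega
    rw [hcard]
    refine homogeneousSubmodule_succ_le fun l => ?_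
    refine ih (W := W.comap (LinearMap.mulLeft ℂ (X l))) (fun x hx => ?_) (fun i hi r hr => ?_)
    · exact hIW (I.mul_mem_left _ hx)
    · have hsi : s ≠ i := fun h => hs (h ▸ hi)
      obtain ⟨α, β, h⟩ := hI s i hsi l
      have h1 := hW i (by simp [hi]) r hr
      have h2 := hW s (by simp) r hr
      rw [Finset.cons_eq_insert, Finset.erase_insert_of_ne hsi,
        Finset.prod_insert (fun h => hs (Finset.mem_of_mem_erase h))] at h1
      rw [Finset.cons_eq_insert, Finset.erase_insert hs, ← Finset.mul_prod_erase Q _ hi] at h2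
      have h3 := W.add_mem (W.add_mem (hIW (I.mul_mem_left ((∏ j ∈ Q.erase i, X j) * r) h))
        (W.smul_mem α h1)) (W.smul_mem β h2)
      rw [Submodule.mem_comap, LinearMap.mulLeft_apply]
      convert h3 using 1
      simp only [smul_eq_C_mul]
      ring

lemma mul_mem_of_mul_X_pow_mem
    (hI : ∀ i j : σ, i ≠ j → ∀ l, ∃ α β : ℂ, X l - C α * X i - C β * X j ∈ I)
    {i l : σ} (hil : i ≠ l) {d : ℕ}
    {W : Submodule ℂ (MvPolynomial σ ℂ)} {K : Ideal (MvPolynomial σ ℂ)} (hIK : I ≤ K)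
    (hKW : K.restrictScalars ℂ ≤ W) {f : MvPolynomial σ ℂ} (hf : X i * f ∈ K)
    (hfW : f * X l ^ d ∈ W) {r : MvPolynomial σ ℂ} (hr : r.IsHomogeneous d) : f * r ∈ W := by
  suffices h : homogeneousSubmodule σ ℂ d ≤ W.comap (LinearMap.mulLeft ℂ f) from h hr
  clear hr r
  induction d generalizing f with
  | zero =>
    rw [homogeneousSubmodule_zero, Submodule.one_le]
    simpa using hfW
  | succ d ih =>
    refine homogeneousSubmodule_succ_le fun s r hr => ?_
    obtain ⟨α, β, h⟩ := hI i l hil s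
    have key : (f * X s) * r ∈ W := by
      refine ih (f := f * X s) ?_ ?_ hr
      · rw [← mul_assoc]; exact K.mul_mem_right _ hf
      · have h3 := W.add_mem (W.add_mem (hKW (K.mul_mem_left (f * X l ^ d) (hIK h)))
          (hKW (K.mul_mem_left (C α * X l ^ d) hf))) (W.smul_mem β hfW)
        convert h3 using 1
        simp only [smul_eq_C_mul]
        ring
    simpa [mul_assoc] using key

end Homogeneous

lemma hdim_eq_card_of_ker {ν k : ℕ} {K : Ideal (MvPolynomial (Fin ν) ℂ)} {ι : Type*} [Fintype ι]
    (E : MvPolynomial (Fin ν) ℂ →ₗ[ℂ] (ι → ℂ))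
    (hker : ∀ p ∈ homogeneousSubmodule (Fin ν) ℂ k, E p = 0 ↔ p ∈ K)
    (hsurj : ∀ c, ∃ p ∈ homogeneousSubmodule (Fin ν) ℂ k, E p = c) :
    hdim K k = Fintype.card ι := by
  set S := homogeneousSubmodule (Fin ν) ℂ k
  have : Module.Finite ℂ S := Module.Finite.iff_fg.2 (homogeneousSubmodule_fg _ _ k)
  have h := (E.domRestrict S).finrank_range_add_finrank_ker
  have hr : LinearMap.range (E.domRestrict S) = ⊤ := LinearMap.range_eq_top.2 fun c => by
    obtain ⟨p, hp, hpc⟩ := hsurj c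
    exact ⟨⟨p, hp⟩, hpc⟩
  have hk : (LinearMap.ker (E.domRestrict S)).map S.subtype = K.restrictScalars ℂ ⊓ S := by
    ext p
    simp only [Submodule.mem_map, LinearMap.mem_ker, Submodule.mem_inf]
    constructor
    · rintro ⟨q, hq, rfl⟩
      exact ⟨(hker q q.2).1 hq, q.2⟩
    · rintro ⟨h1, h2⟩
      exact ⟨⟨p, h2⟩, (hker p h2).2 h1, rfl⟩
  rw [hr, finrank_top, Module.finrank_fintype_fun_eq_card] at h
  rw [hdim, ← hk, Submodule.finrank_map_subtype_eq, ← h, Nat.add_sub_cancel]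

/-- Let `M` be of full rank type, `G` a nonempty finite set of squarefree nonconstant monomials,
`J` the ideal generated by `G`, `n` the number of variables dividing every element of `G` and
`m` the number of variables dividing no element of `G`. Then for every `k ≥ ν − m − 1`:
`dim_ℂ (A/(J + I_M))_k = n`. -/
theorem stmt10 (ν : ℕ) (hν : 3 ≤ ν) (M : Matrix (Fin (ν - 2)) (Fin ν) ℂ)
    (hM : FullRankType ν M) (G : Finset (MvPolynomial (Fin ν) ℂ)) (hGne : G.Nonempty)
    (hGsq : ∀ p ∈ G, ∃ T : Finset (Fin ν), T.Nonempty ∧ p = ∏ i ∈ T, MvPolynomial.X i)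
    (n m : ℕ)
    (hn : n = Set.ncard {i : Fin ν | ∀ p ∈ G, MvPolynomial.X i ∣ p})
    (hm : m = Set.ncard {i : Fin ν | ∀ p ∈ G, ¬ MvPolynomial.X i ∣ p})
    (k : ℕ) (hk : ν - m - 1 ≤ k) :
    hdim (Ideal.span (↑G : Set (MvPolynomial (Fin ν) ℂ)) + IM M) k = n := by
  classical
  choose! T hTne hT using hGsq
  have hdvd : ∀ i, ∀ p ∈ G, (X i ∣ p ↔ i ∈ T p) := fun i p hp => by
    conv_lhs => rw [hT p hp, X_prime.dvd_finsetProd_iff]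
    simp [X_dvd_X]
  set K := Ideal.span (↑G : Set (MvPolynomial (Fin ν) ℂ)) + IM M
  have hGK : ∀ p ∈ G, p ∈ K := fun p hp =>
    Ideal.mem_sup_left (Ideal.subset_span hp)
  have hIK : IM M ≤ K := le_sup_right
  have hI := fun (i j : Fin ν) (h : i ≠ j) => hM.exists_X_sub_mem_IM h
  let Q : Finset (Fin ν) := G.biUnion T
  let N : Finset (Fin ν) := Finset.univ.filter fun i => ∀ p ∈ G, i ∈ T p
  obtain ⟨p₀, hp₀⟩ := hGne
  have hTQ : ∀ p ∈ G, T p ⊆ Q := fun p hp => Finset.subset_biUnion_of_mem T hp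
  have hQ : Q.Nonempty := (hTne p₀ hp₀).mono (hTQ p₀ hp₀)
  have hNQ : N ⊆ Q := fun i hi => hTQ p₀ hp₀ ((Finset.mem_filter.1 hi).2 p₀ hp₀)
  have hnN : n = N.card := by
    rw [hn, ← Set.ncard_coe_finset]
    congr 1
    ext i
    simp only [N, Set.mem_ofPred_eq, Finset.coe_filter, Finset.mem_univ, true_and]
    exact forall₂_congr (hdvd i)
  have hmQ : m = Qᶜ.card := by
    rw [hm, ← Set.ncard_coe_finset]
    congr 1
    ext i
    simp only [Q, Set.mem_ofPred_eq, Finset.coe_compl, Set.mem_compl_iff, Finset.mem_coe,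
      Finset.mem_biUnion, not_exists, not_and]
    exact forall₂_congr fun p hp => not_congr (hdvd i p hp)
  obtain ⟨d, hd⟩ : ∃ d, k = Q.card - 1 + d := by
    have h1 := Finset.card_compl Q
    have h2 := Finset.card_le_univ Q
    rw [Fintype.card_fin] at h1 h2
    exact Nat.exists_eq_add_of_le (by omega)
  have hνt : Nontrivial (Fin ν) := Fin.nontrivial_iff_two_le.2 (by omega)
  choose v hvM hvi hvl using hM.exists_mulVec_eq_zero hν
  choose l hl using fun i : Fin ν => exists_ne i
  let w : Fin ν → MvPolynomial (Fin ν) ℂ := fun i => (∏ j ∈ Q.erase i, X j) * X (l i) ^ d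
  have hw : ∀ i ∈ Q, w i ∈ homogeneousSubmodule (Fin ν) ℂ k := fun i hi => by
    have h1 := IsHomogeneous.prod (R := ℂ) (Q.erase i) (fun j => X j) (fun _ => 1)
      (fun j _ => isHomogeneous_X ℂ j)
    have h2 := h1.mul (isHomogeneous_X_pow (R := ℂ) (l i) d)
    rw [Finset.sum_const, smul_eq_mul, mul_one, Finset.card_erase_of_mem hi, ← hd] at h2
    exact h2
  let E : MvPolynomial (Fin ν) ℂ →ₗ[ℂ] (N → ℂ) :=
    LinearMap.pi fun i => (aeval (v i)).toLinearMap
  have hE : ∀ p i, E p i = aeval (v i) p := fun _ _ => rfl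
  have hEK : ∀ p ∈ K, E p = 0 := fun p hp => by
    ext i
    have hle : K ≤ RingHom.ker (aeval (R := ℂ) (v i)) := by
      refine sup_le (Ideal.span_le.2 fun p hp => ?_) (Ideal.span_le.2 ?_)
      · have hiT := (Finset.mem_filter.1 i.2).2 p hp
        rw [SetLike.mem_coe, RingHom.mem_ker, hT p hp, map_prod]
        exact Finset.prod_eq_zero hiT (by simp [hvi])
      · rintro _ ⟨j, rfl⟩
        have := congrFun (hvM i) j
        simpa [Matrix.mulVec, dotProduct] using this
    exact hle hp
  have hEw : ∀ i j : N, E (w i) j ≠ 0 ↔ i = j := fun i j => by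
    rw [hE]
    constructor
    · intro h
      by_contra hij
      refine h ?_
      have hj : (j : Fin ν) ∈ Q.erase i :=
        Finset.mem_erase.2 ⟨fun h => hij (Subtype.ext h.symm), hNQ j.2⟩
      simp only [w, map_mul, map_prod, aeval_X]
      rw [Finset.prod_eq_zero hj (hvi j), zero_mul]
    · rintro rfl
      simp only [w, map_mul, map_prod, map_pow, aeval_X]
      exact mul_ne_zero (Finset.prod_ne_zero_iff.2 fun t ht =>
        hvl _ _ (Finset.ne_of_mem_erase ht)) (pow_ne_zero _ (hvl _ _ (hl _)))
  have hEsum : ∀ (c : N → ℂ) (j : N), E (∑ i, c i • w i) j = c j * E (w j) j := fun c j => by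
    simp only [map_sum, map_smul, Finset.sum_apply, Pi.smul_apply, smul_eq_mul]
    refine Finset.sum_eq_single j (fun i _ hij => ?_) (by simp)
    rw [not_not.1 (mt (hEw i j).1 hij), mul_zero]
  have hspan : homogeneousSubmodule (Fin ν) ℂ k ≤
      K.restrictScalars ℂ ⊔ Submodule.span ℂ (Set.range fun i : N => w i) := by
    rw [hd]
    refine homogeneousSubmodule_le_of_prod_erase_mem hI hQ (le_sup_of_le_left hIK) ?_
    intro i hi r hr
    by_cases hiN : i ∈ N
    · refine mul_mem_of_mul_X_pow_mem hI (hl i).symm hIK le_sup_left ?_ ?_ hr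
      · rw [Finset.mul_prod_erase Q _ hi]
        refine K.mem_of_dvd ?_ (hGK p₀ hp₀)
        conv_lhs => rw [hT p₀ hp₀]
        exact Finset.prod_dvd_prod_of_subset _ _ _ (hTQ p₀ hp₀)
      · exact Submodule.mem_sup_right (Submodule.subset_span ⟨⟨i, hiN⟩, rfl⟩)
    · obtain ⟨p, hp, hip⟩ : ∃ p ∈ G, i ∉ T p := by simpa [N] using hiN
      refine Submodule.mem_sup_left (K.mul_mem_right _ (K.mem_of_dvd ?_ (hGK p hp)))
      conv_lhs => rw [hT p hp]
      exact Finset.prod_dvd_prod_of_subset _ _ _ (Finset.subset_erase.2 ⟨hTQ p hp, hip⟩)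
  rw [hnN, ← Fintype.card_coe]
  refine hdim_eq_card_of_ker E (fun p hp => ⟨fun h0 => ?_, hEK p⟩) fun c => ?_
  · obtain ⟨q, hq, s, hs, rfl⟩ := Submodule.mem_sup.1 (hspan hp)
    obtain ⟨c, rfl⟩ := (Submodule.mem_span_range_iff_exists_fun ℂ).1 hs
    rw [map_add, hEK q hq, zero_add] at h0
    have hc : ∀ i, c i = 0 := fun i => by
      have := congrFun h0 i
      rw [hEsum] at this
      exact (mul_eq_zero.1 this).resolve_right ((hEw i i).2 rfl)
    simpa [hc] using hq
  · refine ⟨∑ i : N, (c i / E (w i) i) • w i,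
      Submodule.sum_mem _ fun i _ => Submodule.smul_mem _ _ (hw i (hNQ i.2)), ?_⟩
    ext j
    rw [hEsum, div_mul_cancel₀ _ ((hEw j j).2 rfl)]
end

section
/- Let l ≥ 1 be an integer with s_l ≥ 0, and set n_l := #{i ∈ {1,…,ν} : ε_{i,(l_1,l_2)} = 1 for every (l_1,l_2) ∈ Λ_l}. If ν − n_l ≤ 5, then for any two matrices M and M′ of full rank type, dim_ℂ (A/(J(l) + I_M))_{s_l} = dim_ℂ (A/(J(l) + I_{M′}))_{s_l}. In particular, if ν ≤ 5 then this equality holds for every integer l ≥ 1 with s_l ≥ 0 (i.e. the coefficients Q(l) of the Poincaré series of the minimal generators are topological). -/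
open scoped BigOperators

/-- `s_l := l·b₀ − Σ_i ⌈l·ω_i/α_i⌉`. -/
noncomputable def sVal (ν : ℕ) (b0 : ℤ) (α ω : Fin ν → ℤ) (l : ℤ) : ℤ :=
  l * b0 - ∑ i, ⌈((l * ω i : ℤ) : ℚ) / (α i : ℚ)⌉

/-- `ε_{i,(l₁,l₂)} := {l₁·β_i/α_i} + {l₂·β_i/α_i} − {(l₁+l₂)·β_i/α_i}`. -/
noncomputable def epsQ (ν : ℕ) (α β : Fin ν → ℤ) (i : Fin ν) (l₁ l₂ : ℤ) : ℚ :=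
  Int.fract (((l₁ * β i : ℤ) : ℚ) / (α i : ℚ)) + Int.fract (((l₂ * β i : ℤ) : ℚ) / (α i : ℚ)) -
    Int.fract ((((l₁ + l₂) * β i : ℤ) : ℚ) / (α i : ℚ))

/-- The set of monomials `X_l := { ∏_i a_i^{ε_{i,(l₁,l₂)}} : (l₁,l₂) ∈ Λ_l }`. -/
noncomputable def Xset (ν : ℕ) (b0 : ℤ) (α ω β : Fin ν → ℤ) (l : ℤ) :
    Set (MvPolynomial (Fin ν) ℂ) :=
  { p | ∃ l₁ l₂ : ℤ, 1 ≤ l₁ ∧ 1 ≤ l₂ ∧ l₁ + l₂ = l ∧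
      0 ≤ sVal ν b0 α ω l₁ ∧ 0 ≤ sVal ν b0 α ω l₂ ∧
      p = ∏ i, MvPolynomial.X i ^ (if epsQ ν α β i l₁ l₂ = 1 then 1 else 0) }

/-- `J(l)`, the ideal of `A` generated by `X_l`. -/
noncomputable def Jl (ν : ℕ) (b0 : ℤ) (α ω β : Fin ν → ℤ) (l : ℤ) :
    Ideal (MvPolynomial (Fin ν) ℂ) :=
  Ideal.span (Xset ν b0 α ω β l)

open MvPolynomial Module

/-- The binary linear form `u i * x + v i * y`. -/
noncomputable def linForm {ι : Type*} (u v : ι → ℂ) (i : ι) : MvPolynomial (Fin 2) ℂ :=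
  C (u i) * X 0 + C (v i) * X 1

/-- The product of the binary linear forms indexed by `S`. -/
noncomputable def formProd {ι : Type*} (u v : ι → ℂ) (S : Finset ι) : MvPolynomial (Fin 2) ℂ :=
  ∏ i ∈ S, linForm u v i

/-- The ideal generated by the products of linear forms indexed by the members of `F`. -/
noncomputable def formIdeal {ι : Type*} (u v : ι → ℂ) (F : Set (Finset ι)) :
    Ideal (MvPolynomial (Fin 2) ℂ) :=
  Ideal.span (formProd u v '' F)

/-- The linear forms `u i * x + v i * y` are pairwise non-proportional. -/
def NonProportional {ι : Type*} (u v : ι → ℂ) : Prop :=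
  ∀ i j, i ≠ j → u i * v j - u j * v i ≠ 0

section BinaryForms

variable {ι : Type*} {u v : ι → ℂ}

theorem linForm_isHomogeneous (u v : ι → ℂ) (i : ι) : (linForm u v i).IsHomogeneous 1 :=
  (isHomogeneous_C_mul_X _ _).add (isHomogeneous_C_mul_X _ _)

theorem formProd_isHomogeneous (u v : ι → ℂ) (S : Finset ι) :
    (formProd u v S).IsHomogeneous S.card := by
  simpa [formProd] using IsHomogeneous.prod S (linForm u v) (fun _ => 1)
    (fun i _ => linForm_isHomogeneous u v i)

theorem eval_linForm (u v : ι → ℂ) (b i : ι) :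
    eval ![v b, -u b] (linForm u v i) = u i * v b - u b * v i := by
  simp [linForm]; ring

theorem eval_formProd_ne_zero (huv : NonProportional u v) {b : ι} {S : Finset ι} (hb : b ∉ S) :
    eval ![v b, -u b] (formProd u v S) ≠ 0 := by
  rw [formProd, map_prod, Finset.prod_ne_zero_iff]
  intro i hi
  rw [eval_linForm]
  exact huv i b (fun h => hb (h ▸ hi))

theorem eval_formProd_eq_zero {b : ι} {S : Finset ι} (hb : b ∈ S) :
    eval ![v b, -u b] (formProd u v S) = 0 := by
  rw [formProd, map_prod]
  exact Finset.prod_eq_zero hb (by rw [eval_linForm]; ring)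

theorem formProd_ne_zero (huv : NonProportional u v) {S : Finset ι}
    (hS : ∀ i ∈ S, ∃ j, j ≠ i) : formProd u v S ≠ 0 := by
  rw [formProd, Finset.prod_ne_zero_iff]
  intro i hi h
  obtain ⟨j, hj⟩ := hS i hi
  have := eval_linForm u v j i
  rw [h, map_zero] at this
  exact huv i j hj.symm this.symm

theorem homogeneousSubmodule_one_le_span (huv : NonProportional u v) {a b : ι} (hab : a ≠ b) :
    homogeneousSubmodule (Fin 2) ℂ 1 ≤ Submodule.span ℂ {linForm u v a, linForm u v b} := by
  rw [homogeneousSubmodule_one_eq_span_X, Submodule.span_le]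
  have hd := huv a b hab
  rintro _ ⟨i, rfl⟩
  rw [SetLike.mem_coe, Submodule.mem_span_pair]
  have key : ∀ p : MvPolynomial (Fin 2) ℂ, ∀ s t : ℂ,
      s • linForm u v a + t • linForm u v b = (u a * v b - u b * v a) • p →
      ∃ s t : ℂ, s • linForm u v a + t • linForm u v b = p := by
    intro p s t h
    refine ⟨(u a * v b - u b * v a)⁻¹ * s, (u a * v b - u b * v a)⁻¹ * t, ?_⟩
    rw [mul_smul, mul_smul, ← smul_add, h, inv_smul_smul₀ hd]
  fin_cases i
  · refine key _ (v b) (-v a) ?_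
    simp only [linForm, smul_eq_C_mul, map_sub, map_mul, map_neg, Fin.zero_eta]
    ring
  · refine key _ (-u b) (u a) ?_
    simp only [linForm, smul_eq_C_mul, map_sub, map_mul, map_neg, Fin.mk_one]
    ring

theorem exists_eq_smul_pow_add_linForm_mul (huv : NonProportional u v) {a b : ι} (hab : a ≠ b)
    (k : ℕ) {g : MvPolynomial (Fin 2) ℂ} (hg : g.IsHomogeneous (k + 1)) :
    ∃ c : ℂ, ∃ g' : MvPolynomial (Fin 2) ℂ, g'.IsHomogeneous k ∧
      g = c • linForm u v a ^ (k + 1) + linForm u v b * g' := by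
  induction k generalizing g with
  | zero =>
    obtain ⟨s, t, rfl⟩ := Submodule.mem_span_pair.1 (homogeneousSubmodule_one_le_span huv hab hg)
    refine ⟨s, C t, isHomogeneous_C _ _, ?_⟩
    simp only [smul_eq_C_mul]
    ring
  | succ k ih =>
    have hmem : g ∈ homogeneousSubmodule (Fin 2) ℂ 1 * homogeneousSubmodule (Fin 2) ℂ (k + 1) := by
      rw [← homogeneousSubmodule_one_pow (σ := Fin 2) (R := ℂ) (n := k + 1), ← pow_succ',
        homogeneousSubmodule_one_pow]
      exact hg
    clear hg
    induction hmem using Submodule.mul_induction_on' with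
    | mem_mul_mem x hx y hy =>
      obtain ⟨s, t, rfl⟩ :=
        Submodule.mem_span_pair.1 (homogeneousSubmodule_one_le_span huv hab hx)
      obtain ⟨c, g', hg', hyg⟩ := ih hy
      refine ⟨s * c, s • (linForm u v a * g') + t • y, ?_, ?_⟩
      · refine IsHomogeneous.add ?_ ?_
        · have := ((linForm_isHomogeneous u v a).mul hg')
          rw [add_comm 1 k] at this
          exact (homogeneousSubmodule (Fin 2) ℂ (k + 1)).smul_mem s this
        · exact (homogeneousSubmodule (Fin 2) ℂ (k + 1)).smul_mem t hy
      · rw [hyg]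
        simp only [smul_eq_C_mul, map_mul]
        ring
    | add x _ y _ hx hy =>
      obtain ⟨c, g, hg, rfl⟩ := hx
      obtain ⟨d, h, hh, rfl⟩ := hy
      exact ⟨c + d, g + h, hg.add hh, by rw [add_smul]; ring⟩

theorem exists_eq_smul_add_linForm_mul (huv : NonProportional u v) {a b : ι} (hab : a ≠ b)
    {k : ℕ} {g h : MvPolynomial (Fin 2) ℂ} (hg : g.IsHomogeneous (k + 1))
    (hh : h.IsHomogeneous (k + 1)) (hne : eval ![v b, -u b] h ≠ 0) :
    ∃ c : ℂ, ∃ g' : MvPolynomial (Fin 2) ℂ, g'.IsHomogeneous k ∧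
      g = c • h + linForm u v b * g' := by
  obtain ⟨c, g', hg', rfl⟩ := exists_eq_smul_pow_add_linForm_mul huv hab k hg
  obtain ⟨d, h', hh', rfl⟩ := exists_eq_smul_pow_add_linForm_mul huv hab k hh
  have hd : d ≠ 0 := by
    rintro rfl
    apply hne
    rw [zero_smul, zero_add, map_mul, eval_linForm]
    ring
  refine ⟨c * d⁻¹, g' - (c * d⁻¹) • h',
    hg'.sub ((homogeneousSubmodule (Fin 2) ℂ k).smul_mem _ hh'), ?_⟩
  rw [smul_add, smul_smul, mul_assoc, inv_mul_cancel₀ hd, mul_one]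
  simp only [smul_eq_C_mul]
  ring

/-- Lagrange interpolation for binary forms. -/
theorem homogeneousSubmodule_le_span_formProd_erase [DecidableEq ι] [Nontrivial ι]
    (huv : NonProportional u v) {U : Finset ι} (hU : U.Nonempty) :
    homogeneousSubmodule (Fin 2) ℂ (U.card - 1) ≤
      Submodule.span ℂ ((fun b => formProd u v (U.erase b)) '' U) := by
  induction hU using Finset.Nonempty.cons_induction with
  | singleton a =>
    simp [formProd, homogeneousSubmodule_zero, Submodule.one_eq_span]
  | cons b U hb hU ih =>
    obtain ⟨k, hk⟩ : ∃ k, U.card = k + 1 := ⟨U.card - 1, by have := hU.card_pos; omega⟩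
    rw [Finset.card_cons, Nat.add_sub_cancel, hk]
    rw [hk, Nat.add_sub_cancel] at ih
    intro g hg
    obtain ⟨a, hab⟩ := exists_ne b
    obtain ⟨c, g', hg', rfl⟩ := exists_eq_smul_add_linForm_mul huv hab hg
      (hk ▸ formProd_isHomogeneous u v U) (eval_formProd_ne_zero huv hb)
    refine Submodule.add_mem _ (Submodule.smul_mem _ _ (Submodule.subset_span
      ⟨b, by simp, by simp only [Finset.cons_eq_insert, Finset.erase_insert hb]⟩)) ?_
    have := Submodule.mem_map_of_mem (f := LinearMap.mulLeft ℂ (linForm u v b)) (ih hg')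
    rw [Submodule.map_span] at this
    refine Submodule.span_mono ?_ this
    rintro _ ⟨_, ⟨c, hc, rfl⟩, rfl⟩
    have hcb : c ≠ b := fun h => hb (h ▸ hc)
    refine ⟨c, by simp [Finset.mem_coe.1 hc], ?_⟩
    simp only [LinearMap.mulLeft_apply, formProd]
    rw [← Finset.prod_cons (s := U.erase c) (by simp [hb])]
    congr 1
    ext x
    simp only [Finset.mem_erase, Finset.mem_cons]
    constructor
    · rintro ⟨h1, rfl | h2⟩ <;> simp_all
    · rintro (rfl | h2)
      · exact ⟨hcb.symm, Or.inl rfl⟩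
      · exact ⟨h2.1, Or.inr h2.2⟩

theorem homogeneousComponent_mul_of_isHomogeneous {σ R : Type*} [CommRing R]
    {f : MvPolynomial σ R} {d k : ℕ} (hf : f.IsHomogeneous d) (hdk : d ≤ k)
    (g : MvPolynomial σ R) :
    homogeneousComponent k (f * g) = f * homogeneousComponent (k - d) g := by
  let _ : GradedAlgebra (homogeneousSubmodule σ R) := gradedAlgebra
  have h := DirectSum.coe_decompose_mul_of_left_mem_of_le
    (homogeneousSubmodule σ R) (b := g) (show f ∈ homogeneousSubmodule σ R d from hf) hdk
  exact (decomposition.decompose'_apply _ _).symm.trans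
    (h.trans (congrArg (f * ·) (decomposition.decompose'_apply _ _)))

theorem mem_of_mem_formIdeal {F : Set (Finset ι)} {k : ℕ} (hF : ∀ S ∈ F, S.card ≤ k)
    {W : Submodule ℂ (MvPolynomial (Fin 2) ℂ)}
    (hW : ∀ S ∈ F, ∀ g : MvPolynomial (Fin 2) ℂ, g.IsHomogeneous (k - S.card) →
      formProd u v S * g ∈ W)
    {p : MvPolynomial (Fin 2) ℂ} (hp : p ∈ formIdeal u v F) (hpk : p.IsHomogeneous k) :
    p ∈ W := by
  suffices h : ∀ a : MvPolynomial (Fin 2) ℂ, homogeneousComponent k (a * p) ∈ W by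
    simpa [homogeneousComponent_eq_self hpk] using h 1
  clear hpk
  induction hp using Submodule.span_induction with
  | mem x hx =>
    obtain ⟨S, hS, rfl⟩ := hx
    intro a
    rw [mul_comm, homogeneousComponent_mul_of_isHomogeneous (formProd_isHomogeneous u v S) (hF S hS)]
    exact hW S hS _ (homogeneousComponent_isHomogeneous _ _)
  | zero => simp
  | add x y _ _ hx hy =>
    intro a
    rw [mul_add, map_add]
    exact W.add_mem (hx a) (hy a)
  | smul r x _ hx =>
    intro a
    rw [smul_eq_mul, ← mul_assoc]
    exact hx _

theorem mem_ideal_of_isHomogeneous_of_le {J : Ideal (MvPolynomial (Fin 2) ℂ)} {j k : ℕ}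
    (hj : ∀ p : MvPolynomial (Fin 2) ℂ, p.IsHomogeneous j → p ∈ J) (hjk : j ≤ k)
    {p : MvPolynomial (Fin 2) ℂ} (hp : p.IsHomogeneous k) : p ∈ J := by
  have hmem : p ∈ homogeneousSubmodule (Fin 2) ℂ j * homogeneousSubmodule (Fin 2) ℂ (k - j) := by
    rw [← homogeneousSubmodule_one_pow (σ := Fin 2) (R := ℂ) (n := j),
      ← homogeneousSubmodule_one_pow (σ := Fin 2) (R := ℂ) (n := k - j), ← pow_add,
      Nat.add_sub_cancel' hjk, homogeneousSubmodule_one_pow]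
    exact hp
  clear hp
  induction hmem using Submodule.mul_induction_on' with
  | mem_mul_mem x hx y hy => exact J.mul_mem_right _ (hj x hx)
  | add x _ y _ hx hy => exact J.add_mem hx hy

theorem formProd_mem_formIdeal {F : Set (Finset ι)} {S T : Finset ι} (hS : S ∈ F) (hST : S ⊆ T) :
    formProd u v T ∈ formIdeal u v F := by
  classical
  rw [formProd, ← Finset.prod_sdiff hST]
  exact Ideal.mul_mem_left _ _ (Ideal.subset_span ⟨S, hS, rfl⟩)

/-- A family without common index whose union has at most `k + 1` elements generates all binary
forms of degree `k`. -/
theorem mem_formIdeal_of_card_le [Nontrivial ι] (huv : NonProportional u v)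
    {F : Set (Finset ι)} {T : Finset ι} (hT : T.Nonempty) (hFT : ∀ S ∈ F, S ⊆ T)
    (hF : ∀ a ∈ T, ∃ S ∈ F, a ∉ S) {k : ℕ} (hk : T.card ≤ k + 1)
    {p : MvPolynomial (Fin 2) ℂ} (hp : p.IsHomogeneous k) : p ∈ formIdeal u v F := by
  classical
  refine mem_ideal_of_isHomogeneous_of_le (j := T.card - 1) (fun q hq => ?_) (by omega) hp
  have hle : Submodule.span ℂ ((fun b => formProd u v (T.erase b)) '' T) ≤
      (formIdeal u v F).restrictScalars ℂ := by
    rw [Submodule.span_le]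
    rintro _ ⟨b, hb, rfl⟩
    obtain ⟨S, hS, hbS⟩ := hF b hb
    exact formProd_mem_formIdeal hS (Finset.subset_erase.2 ⟨hFT S hS, hbS⟩)
  exact hle (homogeneousSubmodule_le_span_formProd_erase huv hT hq)

theorem mem_formIdeal_of_linForm_mul_mem [Nontrivial ι] (huv : NonProportional u v)
    {F : Set (Finset ι)} {k : ℕ} {a : ι}
    (ha : ∀ q : MvPolynomial (Fin 2) ℂ, q.IsHomogeneous k → linForm u v a * q ∈ formIdeal u v F)
    {S : Finset ι} (hS : S ∈ F) (haS : a ∉ S) (hSk : S.card ≤ k + 1)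
    {p : MvPolynomial (Fin 2) ℂ} (hp : p.IsHomogeneous (k + 1)) : p ∈ formIdeal u v F := by
  obtain ⟨c, hca⟩ := exists_ne a
  have hh : (formProd u v S * linForm u v c ^ (k + 1 - S.card)).IsHomogeneous (k + 1) := by
    have := (formProd_isHomogeneous u v S).mul ((linForm_isHomogeneous u v c).pow (k + 1 - S.card))
    rwa [one_mul, Nat.add_sub_cancel' hSk] at this
  have hne : eval ![v a, -u a] (formProd u v S * linForm u v c ^ (k + 1 - S.card)) ≠ 0 := by
    rw [map_mul, map_pow, eval_linForm]
    exact mul_ne_zero (eval_formProd_ne_zero huv haS) (pow_ne_zero _ (huv c a hca))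
  obtain ⟨s, q, hq, rfl⟩ := exists_eq_smul_add_linForm_mul huv hca hp hh hne
  refine Ideal.add_mem _ ?_ (ha q hq)
  rw [smul_eq_C_mul]
  exact Ideal.mul_mem_left _ _ (Ideal.mul_mem_right _ _ (formProd_mem_formIdeal hS subset_rfl))

/-- Forms of degree at most two: if the union of the family has at least `k + 3` and at most five
elements, the family without common index generates all binary forms of degree `k`. -/
theorem mem_formIdeal_of_le_card [DecidableEq ι] [Nontrivial ι] (huv : NonProportional u v)
    {F : Set (Finset ι)} {T : Finset ι} {k : ℕ} (hFT : ∀ S ∈ F, S ⊆ T) (hFk : ∀ S ∈ F, S.card ≤ k)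
    (hF : ∀ a ∈ T, ∃ S ∈ F, a ∉ S) (hTF : ∀ a ∈ T, ∃ S ∈ F, a ∈ S) (hk : k + 3 ≤ T.card)
    (hT : T.card ≤ 5)
    {p : MvPolynomial (Fin 2) ℂ} (hp : p.IsHomogeneous k) : p ∈ formIdeal u v F := by
  have hTne : T.Nonempty := Finset.card_pos.1 (by omega)
  obtain ⟨t, ht⟩ := hTne
  obtain ⟨S₀, hS₀, htS₀⟩ := hTF t ht
  have hS₀card : 0 < S₀.card := Finset.card_pos.2 ⟨t, htS₀⟩
  have hS₀k := hFk S₀ hS₀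
  by_cases h0 : ∃ S ∈ F, S.card = 0
  · obtain ⟨S, hS, hS0⟩ := h0
    have := formProd_mem_formIdeal (u := u) (v := v) hS subset_rfl
    rw [Finset.card_eq_zero.1 hS0, formProd, Finset.prod_empty] at this
    rw [(Ideal.eq_top_iff_one _).2 this]
    trivial
  by_cases h1 : ∃ S ∈ F, S.card = 1
  · obtain ⟨S, hS, hS1⟩ := h1
    obtain ⟨a, rfl⟩ := Finset.card_eq_one.1 hS1
    obtain ⟨S', hS', haS'⟩ := hF a (hFT _ hS (Finset.mem_singleton_self a))
    obtain ⟨j, rfl⟩ : ∃ j, k = j + 1 := ⟨k - 1, by omega⟩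
    refine mem_formIdeal_of_linForm_mul_mem huv (fun q _ => Ideal.mul_mem_right _ _ ?_) hS' haS'
      (hFk S' hS') hp
    simpa [formProd] using formProd_mem_formIdeal (u := u) (v := v) hS subset_rfl
  have h2 : ∀ S ∈ F, S.card = 2 ∧ k = 2 := by
    intro S hS
    have := hFk S hS
    have : S.card ≠ 0 := fun h => h0 ⟨S, hS, h⟩
    have : S.card ≠ 1 := fun h => h1 ⟨S, hS, h⟩
    omega
  obtain ⟨-, rfl⟩ := h2 S₀ hS₀
  have hT5 : T.card = 5 := by omega
  -- the members of the family cannot be pairwise disjoint, since five is odd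
  have hinter : ∃ S ∈ F, ∃ S' ∈ F, S ≠ S' ∧ ∃ a, a ∈ S ∧ a ∈ S' := by
    by_contra! hdisj
    have hfin : (F ∩ T.powerset).Finite := (Finset.finite_toSet _).inter_of_right _
    have hT' : T = hfin.toFinset.biUnion id := by
      ext a
      simp only [Finset.mem_biUnion, Set.Finite.mem_toFinset, id]
      constructor
      · intro ha
        obtain ⟨S, hS, haS⟩ := hTF a ha
        exact ⟨S, ⟨hS, by simpa using hFT S hS⟩, haS⟩
      · rintro ⟨S, ⟨hS, -⟩, haS⟩
        exact hFT S hS haS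
    have hcard : T.card = ∑ S ∈ hfin.toFinset, S.card := by
      conv_lhs => rw [hT']
      refine Finset.card_biUnion ?_
      intro S hS S' hS' hne
      refine Finset.disjoint_left.2 fun a ha ha' => ?_
      exact hdisj S ((Set.Finite.mem_toFinset _).1 hS).1 S' ((Set.Finite.mem_toFinset _).1 hS').1
        hne a ha ha'
    rw [Finset.sum_congr rfl (g := fun _ => 2)
      (fun S hS => (h2 S ((Set.Finite.mem_toFinset hfin).1 hS).1).1)] at hcard
    simp only [Finset.sum_const, smul_eq_mul] at hcard
    omega
  obtain ⟨S, hS, S', hS', hne, a, haS, haS'⟩ := hinter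
  obtain ⟨b, hb⟩ := Finset.card_eq_one.1
    (show (S.erase a).card = 1 by rw [Finset.card_erase_of_mem haS, (h2 S hS).1])
  obtain ⟨c, hc⟩ := Finset.card_eq_one.1
    (show (S'.erase a).card = 1 by rw [Finset.card_erase_of_mem haS', (h2 S' hS').1])
  have hbc : b ≠ c := by
    rintro rfl
    exact hne (by rw [← Finset.insert_erase haS, hb, ← hc, Finset.insert_erase haS'])
  obtain ⟨S'', hS'', haS''⟩ := hF a (hFT S hS haS)
  refine mem_formIdeal_of_linForm_mul_mem huv (fun q hq => ?_) hS'' haS'' (hFk S'' hS'') hp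
  have hprod : ∀ {R : Finset ι} {d : ι}, R ∈ F → a ∈ R → R.erase a = {d} →
      linForm u v a * linForm u v d ∈ formIdeal u v F := by
    intro R d hR haR hd
    have := formProd_mem_formIdeal (u := u) (v := v) hR subset_rfl
    rwa [formProd, ← Finset.mul_prod_erase R _ haR, hd, Finset.prod_singleton] at this
  obtain ⟨s, t, rfl⟩ := Submodule.mem_span_pair.1 (homogeneousSubmodule_one_le_span huv hbc hq)
  rw [mul_add, mul_smul_comm, mul_smul_comm, smul_eq_C_mul, smul_eq_C_mul]
  exact Ideal.add_mem _ (Ideal.mul_mem_left _ _ (hprod hS haS hb))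
    (Ideal.mul_mem_left _ _ (hprod hS' haS' hc))

/-- The span of the differences of those standard basis vectors indexed by two elements of `T` that
lie outside a common member of `F`. -/
def differenceSpan [DecidableEq ι] (F : Set (Finset ι)) (T : Finset ι) : Submodule ℂ (ι → ℂ) :=
  Submodule.span ℂ {r | ∃ S ∈ F, ∃ a ∈ T, ∃ b ∈ T, a ≠ b ∧ a ∉ S ∧ b ∉ S ∧
    r = Pi.single b 1 - Pi.single a 1}

theorem formProd_mul_formProd_erase_erase [DecidableEq ι] {S T : Finset ι} {a b : ι} (hST : S ⊆ T)
    (ha : a ∉ S) (hb : b ∉ S) :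
    formProd u v S * formProd u v (((T \ S).erase a).erase b) =
      formProd u v ((T.erase a).erase b) := by
  have hS : S ⊆ (T.erase a).erase b :=
    Finset.subset_erase.2 ⟨Finset.subset_erase.2 ⟨hST, ha⟩, hb⟩
  rw [formProd, formProd, formProd, ← Finset.prod_sdiff hS, mul_comm]
  congr 2
  ext x
  simp only [Finset.mem_erase, Finset.mem_sdiff]
  tauto

theorem bracket_smul_formProd_sub [DecidableEq ι] {T : Finset ι} {o a b : ι} (ho : o ∈ T)
    (ha : a ∈ T) (hb : b ∈ T) (hab : a ≠ b) :
    (u o * v b - u b * v o) • formProd u v ((T.erase o).erase b) -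
      (u o * v a - u a * v o) • formProd u v ((T.erase o).erase a) =
      (u a * v b - u b * v a) • formProd u v ((T.erase a).erase b) := by
  rcases eq_or_ne o a with rfl | hoa
  · rw [sub_self, zero_smul, sub_zero]
  rcases eq_or_ne o b with rfl | hob
  · rw [sub_self, zero_smul, zero_sub, Finset.erase_right_comm, ← neg_smul, neg_sub]
  have key : ∀ {x y z : ι}, x ∈ T → x ≠ y → x ≠ z →
      formProd u v ((T.erase y).erase z) =
        linForm u v x * formProd u v (((T.erase y).erase z).erase x) := by
    intro x y z hx hxy hxz
    rw [formProd, formProd, Finset.mul_prod_erase]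
    simp [hx, hxy, hxz]
  have e1 : ((T.erase o).erase a).erase b = ((T.erase a).erase b).erase o := by
    ext x; simp only [Finset.mem_erase]; tauto
  have e2 : ((T.erase o).erase b).erase a = ((T.erase a).erase b).erase o := by
    ext x; simp only [Finset.mem_erase]; tauto
  rw [key ha hoa.symm hab, key hb hob.symm hab.symm, key ho hoa hob, e1, e2]
  simp only [smul_eq_C_mul, linForm, map_sub, map_mul]
  ring

/-- In degree `T.card - 2` the dimension of the ideal is computed by residues. -/
theorem finrank_formIdeal_eq_finrank_differenceSpan [Finite ι] [DecidableEq ι] [Nontrivial ι]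
    (huv : NonProportional u v) {F : Set (Finset ι)} {T : Finset ι} {k : ℕ}
    (hFT : ∀ S ∈ F, S ⊆ T) (hFk : ∀ S ∈ F, S.card ≤ k) (hT : T.card = k + 2) :
    finrank ℂ ((formIdeal u v F).restrictScalars ℂ ⊓ homogeneousSubmodule (Fin 2) ℂ k :
      Submodule ℂ (MvPolynomial (Fin 2) ℂ)) = finrank ℂ (differenceSpan F T) := by
  obtain ⟨o, ho⟩ : T.Nonempty := Finset.card_pos.1 (by omega)
  let h : ι → MvPolynomial (Fin 2) ℂ := fun b =>
    (u o * v b - u b * v o) • formProd u v ((T.erase o).erase b)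
  let Θ : (ι → ℂ) →ₗ[ℂ] MvPolynomial (Fin 2) ℂ :=
    ∑ b ∈ T, (LinearMap.toSpanSingleton ℂ _ (h b)).comp (LinearMap.proj b)
  have hΘ : ∀ r, Θ r = ∑ b ∈ T, r b • h b := by
    intro r
    simp [Θ, LinearMap.sum_apply]
  have hΘd : ∀ a ∈ T, ∀ b ∈ T, a ≠ b → Θ (Pi.single b 1 - Pi.single a 1) =
      (u a * v b - u b * v a) • formProd u v ((T.erase a).erase b) := by
    intro a ha b hb hab
    have hs : ∀ c ∈ T, Θ (Pi.single c 1) = h c := by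
      intro c hc
      rw [hΘ, Finset.sum_eq_single c]
      · simp
      · intro d _ hd
        simp [hd]
      · exact fun h => absurd hc h
    rw [map_sub, hs a ha, hs b hb]
    exact bracket_smul_formProd_sub ho ha hb hab
  have hmap : (differenceSpan F T).map Θ =
      (formIdeal u v F).restrictScalars ℂ ⊓ homogeneousSubmodule (Fin 2) ℂ k := by
    apply le_antisymm
    · rw [differenceSpan, Submodule.map_span, Submodule.span_le]
      rintro _ ⟨_, ⟨S, hS, a, ha, b, hb, hab, haS, hbS, rfl⟩, rfl⟩
      rw [hΘd a ha b hb hab]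
      refine Submodule.smul_mem _ _ ⟨?_, ?_⟩
      · exact formProd_mem_formIdeal hS
          (Finset.subset_erase.2 ⟨Finset.subset_erase.2 ⟨hFT S hS, haS⟩, hbS⟩)
      · have := formProd_isHomogeneous u v ((T.erase a).erase b)
        rwa [Finset.card_erase_of_mem (Finset.mem_erase.2 ⟨hab.symm, hb⟩),
          Finset.card_erase_of_mem ha, hT] at this
    · rintro p ⟨hp, hpk⟩
      refine mem_of_mem_formIdeal hFk ?_ hp hpk
      intro S hS g hg
      have hcard : (T \ S).card = k + 2 - S.card := by
        rw [Finset.card_sdiff_of_subset (hFT S hS), hT]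
      have hSk := hFk S hS
      obtain ⟨a, ha⟩ : (T \ S).Nonempty := Finset.card_pos.1 (by omega)
      have hcard' : ((T \ S).erase a).card = k + 1 - S.card := by
        rw [Finset.card_erase_of_mem ha]; omega
      have hg' := homogeneousSubmodule_le_span_formProd_erase huv
        (U := (T \ S).erase a) (Finset.card_pos.1 (by omega))
        (show g ∈ homogeneousSubmodule (Fin 2) ℂ _ by
          rw [hcard', show k + 1 - S.card - 1 = k - S.card by omega]; exact hg)
      have := Submodule.mem_map_of_mem (f := LinearMap.mulLeft ℂ (formProd u v S)) hg'
      rw [Submodule.map_span] at this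
      refine Submodule.span_le.2 ?_ this
      rintro _ ⟨_, ⟨b, hb, rfl⟩, rfl⟩
      simp only [Finset.mem_coe, Finset.mem_erase, Finset.mem_sdiff] at ha hb
      rw [LinearMap.mulLeft_apply, formProd_mul_formProd_erase_erase (hFT S hS) ha.2 hb.2.2]
      refine ⟨(u a * v b - u b * v a)⁻¹ • (Pi.single b 1 - Pi.single a 1),
        Submodule.smul_mem _ _ (Submodule.subset_span
          ⟨S, hS, a, ha.1, b, hb.2.1, hb.1.symm, ha.2, hb.2.2, rfl⟩), ?_⟩
      rw [map_smul, hΘd a ha.1 b hb.2.1 hb.1.symm, inv_smul_smul₀ (huv a b hb.1.symm)]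
  have hsum : ∀ r ∈ differenceSpan F T, ∑ i ∈ T, r i = 0 ∧ ∀ i ∉ T, r i = 0 := by
    intro r hr
    induction hr using Submodule.span_induction with
    | mem r hr =>
      obtain ⟨S, hS, a, ha, b, hb, hab, -, -, rfl⟩ := hr
      constructor
      · simp [Finset.sum_sub_distrib, Pi.single_apply, ha, hb]
      · intro i hi
        have hia : i ≠ a := fun h => hi (h ▸ ha)
        have hib : i ≠ b := fun h => hi (h ▸ hb)
        simp [hia, hib]
    | zero => simp
    | add x y _ _ hx hy =>
      refine ⟨by simp [Finset.sum_add_distrib, hx.1, hy.1], fun i hi => ?_⟩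
      simp [hx.2 i hi, hy.2 i hi]
    | smul c x _ hx =>
      refine ⟨by simp [← Finset.mul_sum, hx.1], fun i hi => ?_⟩
      simp [hx.2 i hi]
  have hinj : Function.Injective (Θ.domRestrict (differenceSpan F T)) := by
    rw [injective_iff_map_eq_zero]
    rintro ⟨r, hr⟩ h0
    rw [LinearMap.domRestrict_apply] at h0
    obtain ⟨hs, hout⟩ := hsum r hr
    have hne : ∀ b ∈ T, b ≠ o → r b = 0 := by
      intro b hb hbo
      have := congrArg (eval ![v b, -u b]) h0
      rw [hΘ, map_sum, map_zero, Finset.sum_eq_single b] at this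
      · rw [smul_eval, smul_eval] at this
        exact (mul_eq_zero.1 this).resolve_right (mul_ne_zero (huv o b hbo.symm)
          (eval_formProd_ne_zero huv (Finset.notMem_erase _ _)))
      · intro c _ hcb
        rw [smul_eval, smul_eval, eval_formProd_eq_zero, mul_zero, mul_zero]
        simp [hb, hbo, hcb.symm]
      · exact fun h => absurd hb h
    ext i
    by_cases hi : i ∈ T
    · rcases eq_or_ne i o with rfl | hio
      · rwa [Finset.sum_eq_single i hne (fun h => absurd ho h)] at hs
      · exact hne i hi hio
    · exact hout i hi
  rw [← hmap, ← LinearMap.range_domRestrict, LinearMap.finrank_range_of_inj hinj]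

theorem finrank_formIdeal_sdiff [DecidableEq ι] [Nontrivial ι] (huv : NonProportional u v)
    {F : Set (Finset ι)} {N : Finset ι} {k : ℕ} (hN : ∀ S ∈ F, N ⊆ S) (hNk : N.card ≤ k) :
    finrank ℂ ((formIdeal u v F).restrictScalars ℂ ⊓ homogeneousSubmodule (Fin 2) ℂ k :
      Submodule ℂ (MvPolynomial (Fin 2) ℂ)) =
    finrank ℂ ((formIdeal u v ((· \ N) '' F)).restrictScalars ℂ ⊓
      homogeneousSubmodule (Fin 2) ℂ (k - N.card) : Submodule ℂ (MvPolynomial (Fin 2) ℂ)) := by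
  have hN0 : formProd u v N ≠ 0 := formProd_ne_zero huv fun i _ => exists_ne i
  have hideal : formIdeal u v F = Ideal.span {formProd u v N} * formIdeal u v ((· \ N) '' F) := by
    rw [formIdeal, formIdeal, Ideal.span_mul_span', Set.singleton_mul, Set.image_image,
      Set.image_image]
    congr 1
    refine Set.image_congr fun S hS => ?_
    rw [formProd, formProd, formProd, mul_comm, Finset.prod_sdiff (hN S hS)]
  have hinj : Function.Injective (LinearMap.mulLeft ℂ (formProd u v N)) :=
    fun x y hxy => mul_left_cancel₀ hN0 hxy
  have hmap : (formIdeal u v F).restrictScalars ℂ ⊓ homogeneousSubmodule (Fin 2) ℂ k =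
      ((formIdeal u v ((· \ N) '' F)).restrictScalars ℂ ⊓
        homogeneousSubmodule (Fin 2) ℂ (k - N.card)).map (LinearMap.mulLeft ℂ (formProd u v N)) := by
    ext p
    simp only [Submodule.mem_inf, Submodule.restrictScalars_mem, Submodule.mem_map,
      LinearMap.mulLeft_apply, mem_homogeneousSubmodule]
    rw [hideal, Ideal.mem_span_singleton_mul]
    have hNh := formProd_isHomogeneous u v N
    constructor
    · rintro ⟨⟨q, hq, rfl⟩, hp⟩
      refine ⟨q, ⟨hq, ?_⟩, rfl⟩
      have hc := homogeneousComponent_mul_of_isHomogeneous hNh hNk q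
      rw [homogeneousComponent_eq_self hp] at hc
      rw [mul_left_cancel₀ hN0 hc]
      exact homogeneousComponent_isHomogeneous _ _
    · rintro ⟨q, ⟨hq, hqk⟩, rfl⟩
      refine ⟨⟨q, hq, rfl⟩, ?_⟩
      have := hNh.mul hqk
      rwa [Nat.add_sub_cancel' hNk] at this
  rw [hmap]
  exact (LinearEquiv.finrank_eq (Submodule.equivMapOfInjective _ hinj _)).symm

theorem finrank_formIdeal_eq_of_union [Finite ι] [DecidableEq ι] [Nontrivial ι] {u' v' : ι → ℂ}
    (huv : NonProportional u v) (huv' : NonProportional u' v')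
    {F : Set (Finset ι)} {T : Finset ι} {k : ℕ} (hne : F.Nonempty) (hFT : ∀ S ∈ F, S ⊆ T)
    (hFk : ∀ S ∈ F, S.card ≤ k) (hF : ∀ a ∈ T, ∃ S ∈ F, a ∉ S) (hTF : ∀ a ∈ T, ∃ S ∈ F, a ∈ S)
    (hT : T.card ≤ 5) :
    finrank ℂ ((formIdeal u v F).restrictScalars ℂ ⊓ homogeneousSubmodule (Fin 2) ℂ k :
      Submodule ℂ (MvPolynomial (Fin 2) ℂ)) =
    finrank ℂ ((formIdeal u' v' F).restrictScalars ℂ ⊓ homogeneousSubmodule (Fin 2) ℂ k :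
      Submodule ℂ (MvPolynomial (Fin 2) ℂ)) := by
  by_cases hk : T.card = k + 2
  · rw [finrank_formIdeal_eq_finrank_differenceSpan huv hFT hFk hk,
      finrank_formIdeal_eq_finrank_differenceSpan huv' hFT hFk hk]
  have hall : ∀ {x y : ι → ℂ}, NonProportional x y → homogeneousSubmodule (Fin 2) ℂ k ≤
      (formIdeal x y F).restrictScalars ℂ := by
    intro x y hxy p hp
    rcases T.eq_empty_or_nonempty with rfl | hTne
    · obtain ⟨S, hS⟩ := hne
      have := formProd_mem_formIdeal (u := x) (v := y) hS subset_rfl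
      rw [Finset.subset_empty.1 (hFT S hS), formProd, Finset.prod_empty] at this
      rw [(Ideal.eq_top_iff_one _).2 this]
      trivial
    by_cases hk' : T.card ≤ k + 1
    · exact mem_formIdeal_of_card_le hxy hTne hFT hF hk' hp
    · exact mem_formIdeal_of_le_card hxy hFT hFk hF hTF (by omega) hT hp
  rw [inf_eq_right.2 (hall huv), inf_eq_right.2 (hall huv')]

theorem finrank_formIdeal_eq [Fintype ι] [Nontrivial ι] {u' v' : ι → ℂ}
    (huv : NonProportional u v) (huv' : NonProportional u' v')
    {F : Set (Finset ι)} {k : ℕ} (hFk : ∀ S ∈ F, S.card ≤ k)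
    (hcard : {i | ∃ S ∈ F, i ∉ S}.ncard ≤ 5) :
    finrank ℂ ((formIdeal u v F).restrictScalars ℂ ⊓ homogeneousSubmodule (Fin 2) ℂ k :
      Submodule ℂ (MvPolynomial (Fin 2) ℂ)) =
    finrank ℂ ((formIdeal u' v' F).restrictScalars ℂ ⊓ homogeneousSubmodule (Fin 2) ℂ k :
      Submodule ℂ (MvPolynomial (Fin 2) ℂ)) := by
  classical
  rcases F.eq_empty_or_nonempty with rfl | hne
  · have h0 : ∀ x y : ι → ℂ, formIdeal x y (∅ : Set (Finset ι)) = ⊥ := by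
      intro x y
      simp [formIdeal]
    rw [h0, h0]
  let N : Finset ι := Finset.univ.filter fun i => ∀ S ∈ F, i ∈ S
  let T : Finset ι := Finset.univ.filter fun i => (∃ S ∈ F, i ∈ S) ∧ ∃ S ∈ F, i ∉ S
  have hN : ∀ S ∈ F, N ⊆ S := fun S hS i hi => (Finset.mem_filter.1 hi).2 S hS
  have hNk : N.card ≤ k := by
    obtain ⟨S, hS⟩ := hne
    exact (Finset.card_le_card (hN S hS)).trans (hFk S hS)
  rw [finrank_formIdeal_sdiff huv hN hNk, finrank_formIdeal_sdiff huv' hN hNk]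
  refine finrank_formIdeal_eq_of_union (T := T) huv huv' (hne.image _) ?_ ?_ ?_ ?_ ?_
  · rintro _ ⟨S, hS, rfl⟩ i hi
    simp only [Finset.mem_sdiff, N, T, Finset.mem_filter, Finset.mem_univ, true_and] at hi ⊢
    push Not at hi
    exact ⟨⟨S, hS, hi.1⟩, hi.2⟩
  · rintro _ ⟨S, hS, rfl⟩
    have := hFk S hS
    rw [Finset.card_sdiff_of_subset (hN S hS)]
    omega
  · intro a ha
    obtain ⟨S, hS, haS⟩ := (Finset.mem_filter.1 ha).2.2
    exact ⟨_, ⟨S, hS, rfl⟩, fun h => haS (Finset.mem_sdiff.1 h).1⟩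
  · intro a ha
    obtain ⟨⟨S, hS, haS⟩, S', hS', haS'⟩ := (Finset.mem_filter.1 ha).2
    exact ⟨_, ⟨S, hS, rfl⟩, Finset.mem_sdiff.2 ⟨haS, fun h => haS' (hN S' hS' h)⟩⟩
  · refine le_trans ?_ hcard
    rw [← Set.ncard_coe_finset]
    refine Set.ncard_le_ncard (fun i hi => ?_) (Set.toFinite _)
    exact (Finset.mem_filter.1 hi).2.2

end BinaryForms

theorem finrank_map_add_finrank_inf_ker {K V W : Type*} [DivisionRing K] [AddCommGroup V]
    [Module K V] [AddCommGroup W] [Module K W] (f : V →ₗ[K] W) (U : Submodule K V)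
    [FiniteDimensional K U] :
    finrank K (U.map f) + finrank K (U ⊓ LinearMap.ker f : Submodule K V) = finrank K U := by
  have hker : (LinearMap.ker (f.domRestrict U)).map U.subtype = U ⊓ LinearMap.ker f := by
    ext x
    simp [Submodule.mem_map, and_comm]
  rw [← (f.domRestrict U).finrank_range_add_finrank_ker, LinearMap.range_domRestrict, ← hker,
    Submodule.finrank_map_subtype_eq]

theorem hdim_map_eq {m n : ℕ} (φ : MvPolynomial (Fin m) ℂ →ₐ[ℂ] MvPolynomial (Fin n) ℂ)
    (σ : MvPolynomial (Fin n) ℂ →ₐ[ℂ] MvPolynomial (Fin m) ℂ)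
    (hφ : ∀ k p, p.IsHomogeneous k → (φ p).IsHomogeneous k)
    (hσ : ∀ k p, p.IsHomogeneous k → (σ p).IsHomogeneous k)
    (hφσ : ∀ p, φ (σ p) = p) (K : Ideal (MvPolynomial (Fin m) ℂ))
    (hK : ∀ p, p - σ (φ p) ∈ K) (k : ℕ) :
    hdim K k = hdim (K.map φ) k := by
  have hfin : FiniteDimensional ℂ (homogeneousSubmodule (Fin m) ℂ k) :=
    Module.Finite.iff_fg.2 (homogeneousSubmodule_fg _ _ _)
  have hker : LinearMap.ker φ.toLinearMap ≤ K.restrictScalars ℂ := by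
    intro p hp
    have hp' : φ p = 0 := hp
    simpa [hp'] using hK p
  have hsurj : Function.Surjective φ := fun p => ⟨σ p, hφσ p⟩
  have h1 : (homogeneousSubmodule (Fin m) ℂ k).map φ.toLinearMap =
      homogeneousSubmodule (Fin n) ℂ k := by
    apply le_antisymm
    · rintro _ ⟨p, hp, rfl⟩
      exact hφ k p hp
    · intro p hp
      exact ⟨σ p, hσ k p hp, hφσ p⟩
  have h2 : (K.restrictScalars ℂ ⊓ homogeneousSubmodule (Fin m) ℂ k).map φ.toLinearMap =
      (K.map φ).restrictScalars ℂ ⊓ homogeneousSubmodule (Fin n) ℂ k := by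
    apply le_antisymm
    · rintro _ ⟨p, ⟨hpK, hp⟩, rfl⟩
      exact ⟨Ideal.mem_map_of_mem φ hpK, hφ k p hp⟩
    · rintro p ⟨hpK, hp⟩
      obtain ⟨q, hq, rfl⟩ := (Ideal.mem_map_iff_of_surjective φ hsurj).1 hpK
      refine ⟨σ (φ q), ⟨?_, hσ k _ hp⟩, hφσ _⟩
      have := K.sub_mem hq (hK q)
      rwa [sub_sub_cancel] at this
  have hfin' : FiniteDimensional ℂ
      (K.restrictScalars ℂ ⊓ homogeneousSubmodule (Fin m) ℂ k :
        Submodule ℂ (MvPolynomial (Fin m) ℂ)) :=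
    Submodule.finiteDimensional_of_le inf_le_right
  have e1 := finrank_map_add_finrank_inf_ker φ.toLinearMap (homogeneousSubmodule (Fin m) ℂ k)
  have e2 := finrank_map_add_finrank_inf_ker φ.toLinearMap
    (K.restrictScalars ℂ ⊓ homogeneousSubmodule (Fin m) ℂ k)
  have e3 : K.restrictScalars ℂ ⊓ homogeneousSubmodule (Fin m) ℂ k ⊓ LinearMap.ker φ.toLinearMap =
      homogeneousSubmodule (Fin m) ℂ k ⊓ LinearMap.ker φ.toLinearMap := by
    rw [inf_right_comm, inf_eq_right.2 hker, inf_comm]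
  rw [h1] at e1
  rw [h2, e3] at e2
  rw [hdim, hdim]
  omega

theorem FullRankType.eq_zero {ν : ℕ} {M : Matrix (Fin (ν - 2)) (Fin ν) ℂ} (hM : FullRankType ν M)
    {i j : Fin ν} (hij : i ≠ j) {x : Fin ν → ℂ} (hx : M.mulVec x = 0) (hi : x i = 0)
    (hj : x j = 0) : x = 0 := by
  have hcard : ({i, j}ᶜ : Finset (Fin ν)).card = ν - 2 := by
    rw [Finset.card_compl, Finset.card_pair hij, Fintype.card_fin]
  let g := (({i, j}ᶜ : Finset (Fin ν)).orderEmbOfFin hcard).toEmbedding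
  have hmem : ∀ y, y ∉ Set.range g → x y = 0 := by
    intro y hy
    have hr : Set.range g = (({i, j}ᶜ : Finset (Fin ν)) : Set (Fin ν)) :=
      Finset.range_orderEmbOfFin _ hcard
    rw [hr] at hy
    simp only [Finset.coe_compl, Set.mem_compl_iff, not_not, Finset.mem_coe, Finset.mem_insert,
      Finset.mem_singleton] at hy
    rcases hy with rfl | rfl <;> assumption
  have h0 : (M.submatrix id g).mulVec (x ∘ g) = 0 := by
    ext r
    have := congrFun hx r
    simp only [Matrix.mulVec, dotProduct, Matrix.submatrix_apply, id, Function.comp_apply,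
      Pi.zero_apply] at this ⊢
    rw [← this]
    exact Fintype.sum_of_injective g g.injective _ _
      (fun y hy => by rw [hmem y hy, mul_zero]) (fun _ => rfl)
  have hxg := Matrix.eq_zero_of_mulVec_eq_zero (hM g) h0
  ext y
  by_cases hy : y ∈ Set.range g
  · obtain ⟨c, rfl⟩ := hy
    exact congrFun hxg c
  · exact hmem y hy

/-- The quotient by `I_M` is a ring of binary forms in which the variables become pairwise
non-proportional linear forms. -/
theorem exists_hdim_add_IM_eq {ν : ℕ} (hν : 2 ≤ ν) {M : Matrix (Fin (ν - 2)) (Fin ν) ℂ}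
    (hM : FullRankType ν M) :
    ∃ u v : Fin ν → ℂ, NonProportional u v ∧ ∀ (J : Ideal (MvPolynomial (Fin ν) ℂ)) (k : ℕ),
      hdim (J + IM M) k = hdim (J.map (aeval (linForm u v) : _ →ₐ[ℂ] _)) k := by
  let e : Fin (ν - 2) ⊕ Fin 2 ≃ Fin ν := finSumFinEquiv.trans (finCongr (by omega))
  let g : Fin (ν - 2) ↪ Fin ν := Function.Embedding.inl.trans e.toEmbedding
  let N := M.submatrix id g
  let P := M.submatrix id (fun s => e (Sum.inr s))
  have hN : IsUnit N.det := isUnit_iff_ne_zero.2 (hM g)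
  let B := N⁻¹ * P
  have hNB : N * B = P := by rw [← Matrix.mul_assoc, Matrix.mul_nonsing_inv _ hN, Matrix.one_mul]
  let w : Fin ν → Fin 2 → ℂ := fun i =>
    Sum.elim (fun r s => -B r s) (fun t => Pi.single t 1) (e.symm i)
  have hwl : ∀ r s, w (e (Sum.inl r)) s = -B r s := by simp [w]
  have hwr : ∀ t, w (e (Sum.inr t)) = Pi.single t 1 := by simp [w]
  have hMw : ∀ j s, ∑ i, M j i * w i s = 0 := by
    intro j s
    rw [← Equiv.sum_comp e, Fintype.sum_sum_type]
    simp only [hwl, hwr]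
    have := congrFun (congrFun hNB j) s
    simp only [Matrix.mul_apply, N, P, Matrix.submatrix_apply, id] at this
    simp only [Pi.single_apply, mul_neg, Finset.sum_neg_distrib, mul_ite, mul_one, mul_zero,
      Finset.sum_ite_eq, Finset.mem_univ, if_true]
    rw [← this]
    exact neg_add_cancel _
  let u : Fin ν → ℂ := fun i => w i 0
  let v : Fin ν → ℂ := fun i => w i 1
  refine ⟨u, v, ?_, ?_⟩
  · intro i j hij h0
    obtain ⟨z, hz, hz0⟩ := Matrix.exists_mulVec_eq_zero_iff.2
      (show (!![u i, v i; u j, v j] : Matrix (Fin 2) (Fin 2) ℂ).det = 0 by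
        rw [Matrix.det_fin_two_of, ← h0]; ring)
    have hzi := congrFun hz0 0
    have hzj := congrFun hz0 1
    simp [Matrix.mulVec, dotProduct, Fin.sum_univ_two] at hzi hzj
    have hx := hM.eq_zero hij (x := fun y => u y * z 0 + v y * z 1) (by
      ext r
      simp only [Matrix.mulVec, dotProduct, mul_add, Finset.sum_add_distrib, ← mul_assoc,
        ← Finset.sum_mul, Pi.zero_apply, u, v, hMw, zero_mul, add_zero]) hzi hzj
    apply hz
    ext t
    have := congrFun hx (e (Sum.inr t))
    fin_cases t <;> simpa [u, v, hwr] using this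
  · intro J k
    let φ : MvPolynomial (Fin ν) ℂ →ₐ[ℂ] MvPolynomial (Fin 2) ℂ := aeval (linForm u v)
    let σ : MvPolynomial (Fin 2) ℂ →ₐ[ℂ] MvPolynomial (Fin ν) ℂ :=
      aeval fun s => X (e (Sum.inr s))
    have hφσ : ∀ p, φ (σ p) = p := by
      have : φ.comp σ = AlgHom.id ℂ _ := by
        apply MvPolynomial.algHom_ext
        intro t
        fin_cases t <;> simp [φ, σ, linForm, u, v, hwr]
      exact fun p => DFunLike.congr_fun this p
    have hσφ : ∀ p, p - σ (φ p) ∈ IM M := by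
      have : (Ideal.Quotient.mkₐ ℂ (IM M)).comp (σ.comp φ) = Ideal.Quotient.mkₐ ℂ (IM M) := by
        apply MvPolynomial.algHom_ext
        intro i
        obtain ⟨r | t, rfl⟩ := e.surjective i
        · refine (Ideal.Quotient.eq.2 ?_).symm
          have hl : (X (e (Sum.inl r)) - (σ.comp φ) (X (e (Sum.inl r))) :
              MvPolynomial (Fin ν) ℂ) =
              ∑ j, C (N⁻¹ r j) * ∑ i, C (M j i) * X i := by
            have h1 : ∀ i, ∑ j, N⁻¹ r j * M j (e i) =
                Sum.elim (fun r' => if r = r' then 1 else 0) (B r) i := by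
              rintro (r' | s)
              · have := congrFun (congrFun (Matrix.nonsing_inv_mul _ hN) r) r'
                rw [Matrix.mul_apply, Matrix.one_apply] at this
                exact this
              · rfl
            have h2 : ∑ j, C (N⁻¹ r j) * ∑ i, C (M j i) * X i =
                ∑ i, C (∑ j, N⁻¹ r j * M j (e i)) * (X (e i) : MvPolynomial (Fin ν) ℂ) := by
              rw [Equiv.sum_comp e fun i =>
                C (∑ j, N⁻¹ r j * M j i) * (X i : MvPolynomial (Fin ν) ℂ)]
              simp only [Finset.mul_sum, map_sum, Finset.sum_mul, map_mul, mul_assoc]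
              exact Finset.sum_comm
            rw [h2, Fintype.sum_sum_type]
            simp [h1, φ, σ, linForm, u, v, hwl, Fin.sum_univ_two]
            ring
          refine hl.symm ▸ ?_
          exact Ideal.sum_mem _ fun j _ =>
            Ideal.mul_mem_left _ _ (Ideal.subset_span ⟨j, rfl⟩)
        · fin_cases t <;> simp [φ, σ, linForm, u, v, hwr]
      intro p
      exact Ideal.Quotient.eq.1 (DFunLike.congr_fun this p).symm
    have hI : (IM M).map φ = ⊥ := by
      rw [IM, Ideal.map_span, Ideal.span_eq_bot]
      rintro _ ⟨_, ⟨j, rfl⟩, rfl⟩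
      have hu : ∑ i, C (M j i) * C (u i) = (0 : MvPolynomial (Fin 2) ℂ) := by
        simp only [← map_mul, ← map_sum, u, hMw, map_zero]
      have hv : ∑ i, C (M j i) * C (v i) = (0 : MvPolynomial (Fin 2) ℂ) := by
        simp only [← map_mul, ← map_sum, v, hMw, map_zero]
      simp only [φ, map_sum, map_mul, aeval_X, algHom_C, algebraMap_eq, linForm, mul_add,
        ← mul_assoc, Finset.sum_add_distrib, ← Finset.sum_mul, hu, hv, zero_mul, add_zero]
    have hhom : ∀ {m n : ℕ} (f : Fin m → MvPolynomial (Fin n) ℂ), (∀ i, (f i).IsHomogeneous 1) →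
        ∀ k p, p.IsHomogeneous k → (aeval (R := ℂ) f p).IsHomogeneous k := by
      intro m n f hf k p hp
      simpa using hp.aeval f hf
    rw [hdim_map_eq φ σ (hhom _ (linForm_isHomogeneous u v)) (hhom _ fun s => isHomogeneous_X ℂ _)
      hφσ (J + IM M) (fun p => Ideal.mem_sup_right (hσφ p)), Submodule.add_eq_sup,
      Ideal.map_sup, hI, sup_bot_eq]

theorem fract_mul_sub_div (l : ℤ) {a w : ℤ} (ha : a ≠ 0) :
    Int.fract (((l * (a - w) : ℤ) : ℚ) / (a : ℚ)) =
      ⌈((l * w : ℤ) : ℚ) / (a : ℚ)⌉ - ((l * w : ℤ) : ℚ) / (a : ℚ) := by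
  have ha' : (a : ℚ) ≠ 0 := by exact_mod_cast ha
  have h : ((l * (a - w) : ℤ) : ℚ) / (a : ℚ) = (l : ℚ) + -(((l * w : ℤ) : ℚ) / (a : ℚ)) := by
    push_cast
    field_simp
    ring
  rw [h, Int.fract_intCast_add, Int.fract, Int.floor_neg]
  push_cast
  ring

theorem epsQ_nonneg {ν : ℕ} {α β : Fin ν → ℤ} {i : Fin ν} {l₁ l₂ : ℤ} :
    0 ≤ epsQ ν α β i l₁ l₂ := by
  rw [epsQ, sub_nonneg, add_mul, Int.cast_add, add_div]
  exact Int.fract_add_le _ _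

theorem sum_epsQ {ν : ℕ} (b0 : ℤ) {α ω β : Fin ν → ℤ} (hα : ∀ i, α i ≠ 0)
    (hβ : ∀ i, β i = α i - ω i) (l₁ l₂ : ℤ) :
    ∑ i, epsQ ν α β i l₁ l₂ =
      ((sVal ν b0 α ω (l₁ + l₂) - sVal ν b0 α ω l₁ - sVal ν b0 α ω l₂ : ℤ) : ℚ) := by
  simp only [epsQ, hβ, fract_mul_sub_div _ (hα _), sVal]
  push_cast
  simp only [Finset.sum_add_distrib, Finset.sum_sub_distrib, add_mul, add_div]
  ring

/-- The index sets of the monomials in `X_l`. -/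
def supportFamily (ν : ℕ) (b0 : ℤ) (α ω β : Fin ν → ℤ) (l : ℤ) : Set (Finset (Fin ν)) :=
  {S | ∃ l₁ l₂ : ℤ, 1 ≤ l₁ ∧ 1 ≤ l₂ ∧ l₁ + l₂ = l ∧
      0 ≤ sVal ν b0 α ω l₁ ∧ 0 ≤ sVal ν b0 α ω l₂ ∧
      S = Finset.univ.filter fun i => epsQ ν α β i l₁ l₂ = 1}

theorem map_Jl_eq_formIdeal {ν : ℕ} (b0 : ℤ) (α ω β : Fin ν → ℤ) (l : ℤ) (u v : Fin ν → ℂ) :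
    (Jl ν b0 α ω β l).map (aeval (linForm u v) : _ →ₐ[ℂ] _) =
      formIdeal u v (supportFamily ν b0 α ω β l) := by
  have key : ∀ l₁ l₂ : ℤ, (aeval (linForm u v) : _ →ₐ[ℂ] _)
      (∏ i, X i ^ (if epsQ ν α β i l₁ l₂ = 1 then 1 else 0) : MvPolynomial (Fin ν) ℂ) =
      formProd u v (Finset.univ.filter fun i => epsQ ν α β i l₁ l₂ = 1) := by
    intro l₁ l₂
    rw [map_prod, formProd, Finset.prod_filter]
    refine Finset.prod_congr rfl fun i _ => ?_
    split_ifs <;> simp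
  rw [Jl, formIdeal, Ideal.map_span]
  congr 1
  ext p
  constructor
  · rintro ⟨_, ⟨l₁, l₂, h1, h2, h3, h4, h5, rfl⟩, rfl⟩
    exact ⟨_, ⟨l₁, l₂, h1, h2, h3, h4, h5, rfl⟩, (key l₁ l₂).symm⟩
  · rintro ⟨_, ⟨l₁, l₂, h1, h2, h3, h4, h5, rfl⟩, rfl⟩
    exact ⟨_, ⟨l₁, l₂, h1, h2, h3, h4, h5, rfl⟩, key l₁ l₂⟩

theorem card_le_of_mem_supportFamily {ν : ℕ} {b0 : ℤ} {α ω β : Fin ν → ℤ} (hα : ∀ i, α i ≠ 0)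
    (hβ : ∀ i, β i = α i - ω i) {l : ℤ} {S : Finset (Fin ν)}
    (hS : S ∈ supportFamily ν b0 α ω β l) : S.card ≤ (sVal ν b0 α ω l).toNat := by
  obtain ⟨l₁, l₂, -, -, rfl, h₁, h₂, rfl⟩ := hS
  have hle : ((Finset.univ.filter fun i => epsQ ν α β i l₁ l₂ = 1).card : ℚ) ≤
      ∑ i, epsQ ν α β i l₁ l₂ := by
    rw [Finset.card_filter, Nat.cast_sum]
    refine Finset.sum_le_sum fun i _ => ?_
    split_ifs with h
    · rw [h, Nat.cast_one]
    · rw [Nat.cast_zero]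
      exact epsQ_nonneg
  rw [sum_epsQ b0 hα hβ] at hle
  have hle' : ((Finset.univ.filter fun i => epsQ ν α β i l₁ l₂ = 1).card : ℤ) ≤
      sVal ν b0 α ω (l₁ + l₂) - sVal ν b0 α ω l₁ - sVal ν b0 α ω l₂ := by exact_mod_cast hle
  omega

/-- Let `l ≥ 1` with `s_l ≥ 0` and let `n_l` be the number of indices `i` with
`ε_{i,(l₁,l₂)} = 1` for every `(l₁,l₂) ∈ Λ_l`. If `ν − n_l ≤ 5` then the dimension
`dim_ℂ (A/(J(l) + I_M))_{s_l}` is independent of the full rank type matrix `M`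
(in particular, for `ν ≤ 5` the coefficients `Q(l)` are topological). -/
theorem stmt11 (ν : ℕ) (hν : 3 ≤ ν) (b0 : ℤ) (α ω : Fin ν → ℤ)
    (hω : ∀ i, 0 < ω i) (hωα : ∀ i, ω i < α i) (hcop : ∀ i, Int.gcd (α i) (ω i) = 1)
    (e : ℚ) (he : e = -(b0 : ℚ) + ∑ i, (ω i : ℚ) / (α i : ℚ)) (hneg : e < 0)
    (β : Fin ν → ℤ) (hβ : ∀ i, β i = α i - ω i)
    (l : ℤ) (hl : 1 ≤ l) (hsl : 0 ≤ sVal ν b0 α ω l)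
    (nl : ℕ)
    (hnl : nl = Set.ncard {i : Fin ν | ∀ l₁ l₂ : ℤ, 1 ≤ l₁ → 1 ≤ l₂ → l₁ + l₂ = l →
      0 ≤ sVal ν b0 α ω l₁ → 0 ≤ sVal ν b0 α ω l₂ → epsQ ν α β i l₁ l₂ = 1})
    (hsmall : ν - nl ≤ 5)
    (M M' : Matrix (Fin (ν - 2)) (Fin ν) ℂ)
    (hM : FullRankType ν M) (hM' : FullRankType ν M') :
    hdim (Jl ν b0 α ω β l + IM M) (sVal ν b0 α ω l).toNat =
      hdim (Jl ν b0 α ω β l + IM M') (sVal ν b0 α ω l).toNat := by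
  have hα : ∀ i, α i ≠ 0 := fun i => ((hω i).trans (hωα i)).ne'
  have : Nontrivial (Fin ν) := Fin.nontrivial_iff_two_le.2 (by omega)
  obtain ⟨u, v, huv, h⟩ := exists_hdim_add_IM_eq (by omega) hM
  obtain ⟨u', v', huv', h'⟩ := exists_hdim_add_IM_eq (by omega) hM'
  rw [h, h', map_Jl_eq_formIdeal, map_Jl_eq_formIdeal, hdim, hdim,
    finrank_formIdeal_eq huv huv' (fun S hS => card_le_of_mem_supportFamily hα hβ hS)]
  have hset : {i | ∃ S ∈ supportFamily ν b0 α ω β l, i ∉ S} =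
      {i : Fin ν | ∀ l₁ l₂ : ℤ, 1 ≤ l₁ → 1 ≤ l₂ → l₁ + l₂ = l →
        0 ≤ sVal ν b0 α ω l₁ → 0 ≤ sVal ν b0 α ω l₂ → epsQ ν α β i l₁ l₂ = 1}ᶜ := by
    ext i
    simp only [supportFamily, Set.mem_ofPred_eq, Set.mem_compl_iff]
    constructor
    · rintro ⟨_, ⟨l₁, l₂, h1, h2, h3, h4, h5, rfl⟩, hi⟩ hall
      exact hi (by simpa using hall l₁ l₂ h1 h2 h3 h4 h5)
    · intro hall
      push Not at hall
      obtain ⟨l₁, l₂, h1, h2, h3, h4, h5, hne⟩ := hall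
      exact ⟨_, ⟨l₁, l₂, h1, h2, h3, h4, h5, rfl⟩, by simpa using hne⟩
  rwa [hset, Set.ncard_compl _ (Set.toFinite _), ← hnl, Nat.card_fin]
end
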